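/- Let g satisfy the Fermi conditions (F1) and (F2) on U and fix (x₁,0,0)∈U. For each θ∈[−1,1] let γ_θ be the maximal smooth solution of the geodesic equation d²γ^k/dt² = Σ_{i,j} Γ_{ij}{}^k(γ(t))·(dγ^i/dt)(dγ^j/dt) with γ_θ(0)=(x₁,0,0) and γ_θ'(0)=(cosθ, sinθ, 0). Then there is a constant C, depending on g and x₁ but not on θ, such that for all θ∈[−1,1]: |d⁴γ_θ³/dt⁴(0) + cos³θ·sinθ·∂₁∂₂∂₃g₁₁(x₁,0,0)| ≤ C·θ². (The paper's Proposition 3.2, equation (3.6).) -/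

import Mathlib

open Set

noncomputable section

/-- Points of `ℝ³` as functions `Fin 3 → ℝ`. -/
abbrev R3 : Type := Fin 3 → ℝ

/-- 3×3 real matrices. -/
abbrev Mat3 : Type := Matrix (Fin 3) (Fin 3) ℝ

/-- The partial derivative `∂_i f` of a scalar function on `ℝ³`. -/
def pd (i : Fin 3) (f : R3 → ℝ) : R3 → ℝ := fun x => fderiv ℝ f x (Pi.single i 1)

/-- The point `(x₁, 0, 0)` on the axis. -/
def axisPt (x₁ : ℝ) : R3 := ![x₁, 0, 0]

/-- The lowered Christoffel symbols `Γ_{ijk} = (∂_j g_{ik} + ∂_i g_{jk} - ∂_k g_{ij})/2`. -/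
def Γlow (g : R3 → Mat3) (i j k : Fin 3) : R3 → ℝ := fun x =>
  (pd j (fun y => g y i k) x + pd i (fun y => g y j k) x - pd k (fun y => g y i j) x) / 2

/-- The raised Christoffel symbols `Γ_{ij}{}^k = Σ_l Γ_{ijl} g^{lk}`. -/
def Γup (g ginv : R3 → Mat3) (i j k : Fin 3) : R3 → ℝ := fun x =>
  ∑ l : Fin 3, Γlow g i j l x * ginv x l k

/-- Fermi condition (F1) (indices are 0-based: paper's `x₁,x₂,x₃` are `x 0, x 1, x 2`):
`Σ_{k=2}^{3} g_{jk}(x) x_k = x_j` for `j = 2,3` and `Σ_{k=2}^{3} g_{1k}(x) x_k = 0`. -/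
def FermiF1 (g : R3 → Mat3) (U : Set R3) : Prop :=
  ∀ x ∈ U, ∀ j : Fin 3, g x j 1 * x 1 + g x j 2 * x 2 = if j = 0 then 0 else x j

/-- Fermi condition (F2): `g_{jk} = δ_{jk}` and `∂₂ g_{jk} = ∂₃ g_{jk} = 0` on the axis. -/
def FermiF2 (g : R3 → Mat3) (U : Set R3) : Prop :=
  ∀ x₁ : ℝ, axisPt x₁ ∈ U →
    (∀ j k : Fin 3, g (axisPt x₁) j k = if j = k then 1 else 0) ∧
    (∀ j k : Fin 3, pd 1 (fun y => g y j k) (axisPt x₁) = 0 ∧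
      pd 2 (fun y => g y j k) (axisPt x₁) = 0)

/-- `γ` solves the geodesic equation
`d²γ^k/dt² = Σ_{i,j} Γ_{ij}{}^k(γ(t)) (dγ^i/dt)(dγ^j/dt)` on `(-T,T)`. -/
def IsGeodesic (g ginv : R3 → Mat3) (γ : ℝ → R3) (T : ℝ) : Prop :=
  ∀ t ∈ Set.Ioo (-T) T, ∀ k : Fin 3,
    iteratedDeriv 2 γ t k =
      ∑ i : Fin 3, ∑ j : Fin 3, Γup g ginv i j k (γ t) * deriv γ t i * deriv γ t j

lemma contDiffOn_pd {f : R3 → ℝ} {U : Set R3} (hU : IsOpen U)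
    (hf : ContDiffOn ℝ (⊤ : ℕ∞) f U) (i : Fin 3) : ContDiffOn ℝ (⊤ : ℕ∞) (pd i f) U :=
  (hf.fderiv_of_isOpen hU (by simp)).clm_apply contDiffOn_const

lemma pd_comm {f : R3 → ℝ} {U : Set R3} (hU : IsOpen U)
    (hf : ContDiffOn ℝ (⊤ : ℕ∞) f U) (i j : Fin 3) {x : R3} (hx : x ∈ U) :
    pd i (pd j f) x = pd j (pd i f) x := by
  have hfx : ContDiffAt ℝ (⊤ : ℕ∞) f x := hf.contDiffAt (hU.mem_nhds hx)
  have hd : DifferentiableAt ℝ (fderiv ℝ f) x :=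
    (hfx.fderiv_right (m := 1) (by norm_cast)).differentiableAt (by simp)
  have key : ∀ a b : Fin 3,
      pd a (pd b f) x = fderiv ℝ (fderiv ℝ f) x (Pi.single a 1) (Pi.single b 1) := by
    intro a b
    have h := (hd.hasFDerivAt.clm_apply
      (hasFDerivAt_const (Pi.single b (1 : ℝ) : R3) x)).fderiv
    change fderiv ℝ (fun y => fderiv ℝ f y (Pi.single b 1)) x (Pi.single a 1) = _
    rw [h]
    simp
  rw [key, key]
  exact (hfx.isSymmSndFDerivAt (by simp; exact WithTop.coe_le_coe.2 le_top)) _ _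

lemma hasDerivAt_comp_pd {P : R3 → ℝ} {γ : ℝ → R3} {t : ℝ} {v : R3}
    (hP : DifferentiableAt ℝ P (γ t)) (hγ : HasDerivAt γ v t) :
    HasDerivAt (fun s => P (γ s)) (∑ n, pd n P (γ t) * v n) t := by
  have h := hP.hasFDerivAt.comp_hasDerivAt t hγ
  have hv : v = ∑ n, v n • (Pi.single n 1 : R3) := by
    ext k
    simp [Finset.sum_apply, Pi.single_apply]
  have hsum : ∑ n, pd n P (γ t) * v n = fderiv ℝ P (γ t) v := by
    conv_rhs => rw [hv, map_sum]
    exact Finset.sum_congr rfl fun n _ => by rw [map_smul, smul_eq_mul, mul_comm, pd]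
  rw [hsum]
  exact h

lemma hasDerivAt_axisPt (s : ℝ) : HasDerivAt axisPt (Pi.single 0 1) s := by
  rw [hasDerivAt_pi]
  intro i
  fin_cases i
  · simpa [axisPt] using hasDerivAt_id' s
  · simpa [axisPt] using hasDerivAt_const s (0 : ℝ)
  · simpa [axisPt] using hasDerivAt_const s (0 : ℝ)

lemma pd_zero_congr_axis {f h : R3 → ℝ} {U : Set R3} (hU : IsOpen U)
    (hf : DifferentiableOn ℝ f U) (hh : DifferentiableOn ℝ h U)
    (heq : ∀ s, axisPt s ∈ U → f (axisPt s) = h (axisPt s)) {s : ℝ} (hs : axisPt s ∈ U) :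
    pd 0 f (axisPt s) = pd 0 h (axisPt s) := by
  have h1 := ((hf.differentiableAt (hU.mem_nhds hs)).hasFDerivAt.comp_hasDerivAt s
    (hasDerivAt_axisPt s))
  have h2 := ((hh.differentiableAt (hU.mem_nhds hs)).hasFDerivAt.comp_hasDerivAt s
    (hasDerivAt_axisPt s))
  refine h1.unique (h2.congr_of_eventuallyEq ?_)
  filter_upwards [(hasDerivAt_axisPt s).continuousAt.preimage_mem_nhds (hU.mem_nhds hs)]
    with r hr using heq r hr

lemma pd_zero_eq_zero_of_axis {f : R3 → ℝ} {U : Set R3} (hU : IsOpen U)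
    (hf : DifferentiableOn ℝ f U) (c : ℝ) (heq : ∀ s, axisPt s ∈ U → f (axisPt s) = c)
    {s : ℝ} (hs : axisPt s ∈ U) : pd 0 f (axisPt s) = 0 := by
  rw [pd_zero_congr_axis (h := fun _ => c) hU hf (differentiableOn_const c) heq hs]
  simp [pd]

lemma contDiffOn_inverse {g ginv : R3 → Mat3} {U : Set R3}
    (hg : ∀ i j : Fin 3, ContDiffOn ℝ (⊤ : ℕ∞) (fun x => g x i j) U)
    (hinv : ∀ x ∈ U, g x * ginv x = 1) (i j : Fin 3) :
    ContDiffOn ℝ (⊤ : ℕ∞) (fun x => ginv x i j) U := by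
  have hdet : ∀ x ∈ U, (g x).det ≠ 0 := fun x hx h => by
    simpa [h] using congrArg Matrix.det (hinv x hx)
  have heq : ∀ x ∈ U, ginv x i j = ((g x).det)⁻¹ * (g x).adjugate i j := fun x hx => by
    rw [← Matrix.inv_eq_right_inv (hinv x hx), Matrix.inv_def]
    simp
  refine ContDiffOn.congr ?_ heq
  refine ContDiffOn.mul (ContDiffOn.inv ?_ hdet) ?_
  · simp only [Matrix.det_fin_three]
    fun_prop
  · simp only [Matrix.adjugate_fin_three]
    fin_cases i <;> fin_cases j <;> simp <;> fun_prop

lemma contDiffOn_Γlow {g : R3 → Mat3} {U : Set R3} (hU : IsOpen U)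
    (hg : ∀ i j : Fin 3, ContDiffOn ℝ (⊤ : ℕ∞) (fun x => g x i j) U) (i j k : Fin 3) :
    ContDiffOn ℝ (⊤ : ℕ∞) (Γlow g i j k) U :=
  (((contDiffOn_pd hU (hg i k) j).add (contDiffOn_pd hU (hg j k) i)).sub
    (contDiffOn_pd hU (hg i j) k)).div_const 2

lemma contDiffOn_Γup {g ginv : R3 → Mat3} {U : Set R3} (hU : IsOpen U)
    (hg : ∀ i j : Fin 3, ContDiffOn ℝ (⊤ : ℕ∞) (fun x => g x i j) U)
    (hinv : ∀ x ∈ U, g x * ginv x = 1) (i j k : Fin 3) :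
    ContDiffOn ℝ (⊤ : ℕ∞) (Γup g ginv i j k) U :=
  ContDiffOn.sum fun l _ =>
    (contDiffOn_Γlow hU hg i j l).mul (contDiffOn_inverse hg hinv l k)

lemma differentiableAt_of_contDiffOn {f : R3 → ℝ} {U : Set R3} (hU : IsOpen U)
    (hf : ContDiffOn ℝ (⊤ : ℕ∞) f U) {x : R3} (hx : x ∈ U) : DifferentiableAt ℝ f x :=
  (hf.differentiableOn (by simp)).differentiableAt (hU.mem_nhds hx)

lemma Γlow_axis {g : R3 → Mat3} {U : Set R3} (hU : IsOpen U)
    (hg : ∀ i j : Fin 3, ContDiffOn ℝ (⊤ : ℕ∞) (fun x => g x i j) U) (hF2 : FermiF2 g U)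
    (i j k : Fin 3) {s : ℝ} (hs : axisPt s ∈ U) : Γlow g i j k (axisPt s) = 0 := by
  have h : ∀ a b c : Fin 3, pd a (fun y => g y b c) (axisPt s) = 0 := by
    intro a b c
    fin_cases a
    · exact pd_zero_eq_zero_of_axis hU ((hg b c).differentiableOn (by simp)) _
        (fun r hr => (hF2 r hr).1 b c) hs
    · exact ((hF2 s hs).2 b c).1
    · exact ((hF2 s hs).2 b c).2
  simp [Γlow, h]

lemma Γup_axis {g ginv : R3 → Mat3} {U : Set R3} (hU : IsOpen U)
    (hg : ∀ i j : Fin 3, ContDiffOn ℝ (⊤ : ℕ∞) (fun x => g x i j) U) (hF2 : FermiF2 g U)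
    (i j k : Fin 3) {s : ℝ} (hs : axisPt s ∈ U) : Γup g ginv i j k (axisPt s) = 0 := by
  simp [Γup, Γlow_axis hU hg hF2 _ _ _ hs]

lemma pd_Γup_axis {g ginv : R3 → Mat3} {U : Set R3} (hU : IsOpen U)
    (hg : ∀ i j : Fin 3, ContDiffOn ℝ (⊤ : ℕ∞) (fun x => g x i j) U)
    (hinv : ∀ x ∈ U, g x * ginv x = 1) (hF2 : FermiF2 g U)
    (m i j k : Fin 3) {s : ℝ} (hs : axisPt s ∈ U) :
    pd m (Γup g ginv i j k) (axisPt s) = pd m (Γlow g i j k) (axisPt s) := by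
  have hone : ginv (axisPt s) = 1 := by
    have h1 : g (axisPt s) = 1 := by
      ext a b
      rw [(hF2 s hs).1 a b, Matrix.one_apply]
    simpa [h1] using hinv _ hs
  have hterm : ∀ l : Fin 3, HasFDerivAt (fun x => Γlow g i j l x * ginv x l k) _ (axisPt s) :=
    fun l => (differentiableAt_of_contDiffOn hU (contDiffOn_Γlow hU hg i j l) hs).hasFDerivAt.mul
      (differentiableAt_of_contDiffOn hU (contDiffOn_inverse hg hinv l k) hs).hasFDerivAt
  have hsum := HasFDerivAt.fun_sum (u := Finset.univ) fun l _ => hterm l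
  change fderiv ℝ (fun x => ∑ l : Fin 3, Γlow g i j l x * ginv x l k) (axisPt s) _ = _
  rw [hsum.fderiv]
  simp [Γlow_axis hU hg hF2 _ _ _ hs, hone, Matrix.one_apply, pd]

lemma pd_one_Γup_axis {g ginv : R3 → Mat3} {U : Set R3} (hU : IsOpen U)
    (hg : ∀ i j : Fin 3, ContDiffOn ℝ (⊤ : ℕ∞) (fun x => g x i j) U)
    (hinv : ∀ x ∈ U, g x * ginv x = 1) (hF2 : FermiF2 g U) {s : ℝ} (hs : axisPt s ∈ U) :
    pd 1 (Γup g ginv 0 0 2) (axisPt s) =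
      -(1 / 2) * pd 1 (pd 2 fun y => g y 0 0) (axisPt s) := by
  rw [pd_Γup_axis hU hg hinv hF2 _ _ _ _ hs]
  have hA := (differentiableAt_of_contDiffOn hU (contDiffOn_pd hU (hg 0 2) 0) hs).hasFDerivAt
  have hB := (differentiableAt_of_contDiffOn hU (contDiffOn_pd hU (hg 0 0) 2) hs).hasFDerivAt
  have hzero : pd 1 (pd 0 fun y => g y 0 2) (axisPt s) = 0 := by
    rw [pd_comm hU (hg 0 2) 1 0 hs]
    exact pd_zero_eq_zero_of_axis hU ((contDiffOn_pd hU (hg 0 2) 1).differentiableOn (by simp)) 0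
      (fun r hr => ((hF2 r hr).2 0 2).1) hs
  have hΓ := ((hA.add hA).sub hB).mul_const (2⁻¹ : ℝ)
  have hfun : Γlow g 0 0 2 = fun x => (pd 0 (fun y => g y 0 2) x + pd 0 (fun y => g y 0 2) x
      - pd 2 (fun y => g y 0 0) x) * 2⁻¹ := by
    funext x
    simp [Γlow, div_eq_mul_inv]
  have hd : pd 1 (Γlow g 0 0 2) (axisPt s) = 2⁻¹ * (pd 1 (pd 0 fun y => g y 0 2) (axisPt s)
      + pd 1 (pd 0 fun y => g y 0 2) (axisPt s) - pd 1 (pd 2 fun y => g y 0 0) (axisPt s)) := by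
    conv_lhs => rw [pd, hfun]
    erw [hΓ.fderiv]
    rfl
  rw [hd, hzero]
  ring

lemma pd_zero_pd_one_Γup_axis {g ginv : R3 → Mat3} {U : Set R3} (hU : IsOpen U)
    (hg : ∀ i j : Fin 3, ContDiffOn ℝ (⊤ : ℕ∞) (fun x => g x i j) U)
    (hinv : ∀ x ∈ U, g x * ginv x = 1) (hF2 : FermiF2 g U) {s : ℝ} (hs : axisPt s ∈ U) :
    pd 0 (pd 1 (Γup g ginv 0 0 2)) (axisPt s) =
      -(1 / 2) * pd 0 (pd 1 (pd 2 fun y => g y 0 0)) (axisPt s) := by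
  have hK : DifferentiableOn ℝ (pd 1 (pd 2 fun y => g y 0 0)) U :=
    (contDiffOn_pd hU (contDiffOn_pd hU (hg 0 0) 2) 1).differentiableOn (by simp)
  rw [pd_zero_congr_axis (h := fun x => -(1 / 2) * pd 1 (pd 2 fun y => g y 0 0) x) hU
    ((contDiffOn_pd hU (contDiffOn_Γup hU hg hinv 0 0 2) 1).differentiableOn (by simp))
    (hK.const_mul _) (fun r hr => pd_one_Γup_axis hU hg hinv hF2 hr) hs]
  conv_lhs => rw [pd]
  rw [((hK.differentiableAt (hU.mem_nhds hs)).hasFDerivAt.const_mul (-(1 / 2) : ℝ)).fderiv]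
  rfl

lemma hasDerivAt_iteratedDeriv {γ : ℝ → R3} {T : ℝ}
    (hγ : ContDiffOn ℝ (⊤ : ℕ∞) γ (Set.Ioo (-T) T)) (n : ℕ) {t : ℝ} (ht : t ∈ Set.Ioo (-T) T) :
    HasDerivAt (iteratedDeriv n γ) (iteratedDeriv (n + 1) γ t) t := by
  rw [iteratedDeriv_succ]
  have h : ContDiffOn ℝ (⊤ : ℕ∞) (iteratedDeriv n γ) (Set.Ioo (-T) T) := by
    induction n with
    | zero => simpa using hγ
    | succ n ih =>
      rw [iteratedDeriv_succ]
      exact ih.deriv_of_isOpen isOpen_Ioo (by simp)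
  exact ((h.differentiableOn (by simp)).differentiableAt (isOpen_Ioo.mem_nhds ht)).hasDerivAt

/-- The fourth derivative of a solution of `γ'' = P(γ)(γ', γ')` at a time where the coefficients
`P` and the acceleration vanish. -/
lemma iteratedDeriv_four_of_quadratic {P : Fin 3 → Fin 3 → R3 → ℝ} {U : Set R3} (hU : IsOpen U)
    (hP : ∀ i j, ContDiffOn ℝ (⊤ : ℕ∞) (P i j) U) {γ : ℝ → R3} {T : ℝ} (hT : 0 < T)
    (hγ : ContDiffOn ℝ (⊤ : ℕ∞) γ (Set.Ioo (-T) T)) (hmaps : Set.MapsTo γ (Set.Ioo (-T) T) U)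
    (k : Fin 3)
    (hode : ∀ t ∈ Set.Ioo (-T) T,
      iteratedDeriv 2 γ t k = ∑ i, ∑ j, P i j (γ t) * deriv γ t i * deriv γ t j)
    (hP0 : ∀ i j, P i j (γ 0) = 0) (hγ2 : iteratedDeriv 2 γ 0 = 0) :
    iteratedDeriv 4 γ 0 k = ∑ i, ∑ j, ∑ n, ∑ m, pd m (pd n (P i j)) (γ 0) *
      deriv γ 0 m * deriv γ 0 n * deriv γ 0 i * deriv γ 0 j := by
  have h0 : (0 : ℝ) ∈ Set.Ioo (-T) T := ⟨by linarith, hT⟩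
  have hw : ∀ t ∈ Set.Ioo (-T) T, ∀ i,
      HasDerivAt (fun s => deriv γ s i) (iteratedDeriv 2 γ t i) t := fun t ht i => by
    have h := hasDerivAt_iteratedDeriv hγ 1 ht
    rw [iteratedDeriv_one] at h
    exact hasDerivAt_pi.1 h i
  have hγd : ∀ t ∈ Set.Ioo (-T) T, HasDerivAt γ (deriv γ t) t := fun t ht => by
    simpa [iteratedDeriv_one] using hasDerivAt_iteratedDeriv hγ 0 ht
  have hx : ∀ t ∈ Set.Ioo (-T) T, ∀ n i,
      HasDerivAt (fun s => iteratedDeriv n γ s i) (iteratedDeriv (n + 1) γ t i) t :=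
    fun t ht n i => hasDerivAt_pi.1 (hasDerivAt_iteratedDeriv hγ n ht) i
  have hcomp : ∀ Q : R3 → ℝ, ContDiffOn ℝ (⊤ : ℕ∞) Q U → ∀ t ∈ Set.Ioo (-T) T,
      HasDerivAt (fun s => Q (γ s)) (∑ n, pd n Q (γ t) * deriv γ t n) t := fun Q hQ t ht =>
    hasDerivAt_comp_pd (differentiableAt_of_contDiffOn hU hQ (hmaps ht)) (hγd t ht)
  have h3 : ∀ t ∈ Set.Ioo (-T) T, iteratedDeriv 3 γ t k = ∑ i, ∑ j,
      (((∑ n, pd n (P i j) (γ t) * deriv γ t n) * deriv γ t i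
        + P i j (γ t) * iteratedDeriv 2 γ t i) * deriv γ t j
        + P i j (γ t) * deriv γ t i * iteratedDeriv 2 γ t j) := fun t ht => by
    refine (hx t ht 2 k).unique (HasDerivAt.congr_of_eventuallyEq ?_
      (Filter.eventually_of_mem (isOpen_Ioo.mem_nhds ht) hode))
    exact HasDerivAt.fun_sum fun i _ => HasDerivAt.fun_sum fun j _ =>
      ((hcomp _ (hP i j) t ht).mul (hw t ht i)).mul (hw t ht j)
  refine (hx 0 h0 3 k).unique (HasDerivAt.congr_of_eventuallyEq ?_
    (Filter.eventually_of_mem (isOpen_Ioo.mem_nhds h0) h3))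
  have hd : ∀ i j, HasDerivAt (fun t =>
      (((∑ n, pd n (P i j) (γ t) * deriv γ t n) * deriv γ t i
        + P i j (γ t) * iteratedDeriv 2 γ t i) * deriv γ t j
        + P i j (γ t) * deriv γ t i * iteratedDeriv 2 γ t j)) _ 0 := fun i j =>
    (((((HasDerivAt.fun_sum (u := Finset.univ) fun n _ =>
      (hcomp _ (contDiffOn_pd hU (hP i j) n) 0 h0).mul (hw 0 h0 n)).mul (hw 0 h0 i)).add
      ((hcomp _ (hP i j) 0 h0).mul (hx 0 h0 2 i))).mul (hw 0 h0 j)).add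
      (((hcomp _ (hP i j) 0 h0).mul (hw 0 h0 i)).mul (hx 0 h0 2 j)))
  convert HasDerivAt.fun_sum (u := Finset.univ) fun i _ =>
    HasDerivAt.fun_sum (u := Finset.univ) fun j _ => hd i j using 1
  simp [hγ2, hP0, Finset.sum_mul]

lemma exists_bound_quartic (A : Fin 3 → Fin 3 → Fin 3 → Fin 3 → ℝ) (K : ℝ)
    (h00 : ∀ i j, A 0 0 i j = 0) (h01 : A 0 1 0 0 = -(1 / 2) * K)
    (h10 : A 1 0 0 0 = -(1 / 2) * K) :
    ∃ C : ℝ, ∀ θ : ℝ, ∀ v : R3, v = ![Real.cos θ, Real.sin θ, 0] →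
      |(∑ i, ∑ j, ∑ n, ∑ m, A m n i j * v m * v n * v i * v j)
        + Real.cos θ ^ 3 * Real.sin θ * K| ≤ C * θ ^ 2 := by
  obtain ⟨B₁, hB₁⟩ : ∃ b, b = A 1 1 0 0 + A 0 1 0 1 + A 0 1 1 0 + A 1 0 0 1 + A 1 0 1 0 :=
    ⟨_, rfl⟩
  obtain ⟨B₂, hB₂⟩ : ∃ b, b = A 1 1 0 1 + A 1 1 1 0 + A 0 1 1 1 + A 1 0 1 1 := ⟨_, rfl⟩
  refine ⟨|B₁| + |B₂| + |A 1 1 1 1|, ?_⟩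
  rintro θ v rfl
  have hexp : (∑ i, ∑ j, ∑ n, ∑ m, A m n i j * (![Real.cos θ, Real.sin θ, 0] : R3) m
        * (![Real.cos θ, Real.sin θ, 0] : R3) n * (![Real.cos θ, Real.sin θ, 0] : R3) i
        * (![Real.cos θ, Real.sin θ, 0] : R3) j) + Real.cos θ ^ 3 * Real.sin θ * K
      = (B₁ * (Real.cos θ * Real.cos θ) + B₂ * (Real.cos θ * Real.sin θ)
        + A 1 1 1 1 * (Real.sin θ * Real.sin θ)) * Real.sin θ ^ 2 := by
    simp only [Fin.sum_univ_three, Matrix.cons_val_zero, Matrix.cons_val_one, Matrix.cons_val,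
      mul_zero, zero_mul, add_zero, h00, h01, h10, hB₁, hB₂]
    ring
  have hc := Real.abs_cos_le_one θ
  have hs := Real.abs_sin_le_one θ
  have hmul : ∀ B a b : ℝ, |a| ≤ 1 → |b| ≤ 1 → |B * (a * b)| ≤ |B| := fun B a b ha hb => by
    rw [abs_mul, abs_mul]
    exact mul_le_of_le_one_right (abs_nonneg _) (mul_le_one₀ ha (abs_nonneg _) hb)
  rw [hexp, abs_mul, abs_of_nonneg (sq_nonneg (Real.sin θ))]
  refine mul_le_mul ?_ (sq_le_sq.2 Real.abs_sin_le_abs) (sq_nonneg _) (by positivity)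
  refine (abs_add_le _ _).trans (add_le_add ((abs_add_le _ _).trans (add_le_add ?_ ?_)) ?_)
  exacts [hmul _ _ _ hc hc, hmul _ _ _ hc hs, hmul _ _ _ hs hs]

/-- the paper's Proposition 3.2, equation (3.6): there is a constant `C`,
depending on `g` and `x₁` but not on `θ`, such that any geodesic with
`γ(0) = (x₁,0,0)`, `γ'(0) = (cos θ, sin θ, 0)` satisfies
`|d⁴γ³/dt⁴(0) + cos³θ sinθ ∂₁∂₂∂₃g₁₁(x₁,0,0)| ≤ C θ²` for all `θ ∈ [-1,1]`. -/
theorem stmt15 (g ginv : R3 → Mat3) (U : Set R3) (hUopen : IsOpen U)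
    (hUseg : ∀ s : ℝ, |s| < 1 → axisPt s ∈ U)
    (hsmooth : ∀ i j : Fin 3, ContDiffOn ℝ (⊤ : ℕ∞) (fun x => g x i j) U)
    (hsym : ∀ x ∈ U, (g x).IsSymm) (hpos : ∀ x ∈ U, (g x).PosDef)
    (hinv : ∀ x ∈ U, g x * ginv x = 1)
    (hF1 : FermiF1 g U) (hF2 : FermiF2 g U)
    (x₁ : ℝ) (hx : axisPt x₁ ∈ U) :
    ∃ C : ℝ, ∀ θ ∈ Set.Icc (-1:ℝ) 1, ∀ T : ℝ, 0 < T → ∀ γ : ℝ → R3,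
      ContDiffOn ℝ (⊤ : ℕ∞) γ (Set.Ioo (-T) T) →
      Set.MapsTo γ (Set.Ioo (-T) T) U →
      IsGeodesic g ginv γ T →
      γ 0 = axisPt x₁ →
      deriv γ 0 = ![Real.cos θ, Real.sin θ, 0] →
      |iteratedDeriv 4 γ 0 2 + Real.cos θ ^ 3 * Real.sin θ *
          pd 0 (pd 1 (pd 2 (fun y => g y 0 0))) (axisPt x₁)| ≤ C * θ ^ 2 := by
  have hΓ := fun i j => contDiffOn_Γup hUopen hsmooth hinv i j 2
  obtain ⟨C, hC⟩ := exists_bound_quartic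
    (fun m n i j => pd m (pd n (Γup g ginv i j 2)) (axisPt x₁))
    (pd 0 (pd 1 (pd 2 fun y => g y 0 0)) (axisPt x₁))
    (fun i j => pd_zero_eq_zero_of_axis hUopen
      ((contDiffOn_pd hUopen (hΓ i j) 0).differentiableOn (by simp)) 0
      (fun _ hr => pd_zero_eq_zero_of_axis hUopen ((hΓ i j).differentiableOn (by simp)) 0
        (fun _ hs => Γup_axis hUopen hsmooth hF2 i j 2 hs) hr) hx)
    (pd_zero_pd_one_Γup_axis hUopen hsmooth hinv hF2 hx)
    ((pd_comm hUopen (hΓ 0 0) 1 0 hx).trans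
      (pd_zero_pd_one_Γup_axis hUopen hsmooth hinv hF2 hx))
  refine ⟨C, fun θ _ T hT γ hγ hmaps hgeo hγ0 hγ1 => ?_⟩
  have h2 : iteratedDeriv 2 γ 0 = 0 := by
    ext k
    rw [hgeo 0 ⟨by linarith, hT⟩ k, hγ0]
    simp [Γup_axis hUopen hsmooth hF2 _ _ _ hx]
  rw [iteratedDeriv_four_of_quadratic hUopen hΓ hT hγ hmaps 2 (fun t ht => hgeo t ht 2)
    (fun i j => by rw [hγ0]; exact Γup_axis hUopen hsmooth hF2 i j 2 hx) h2, hγ0]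
  exact hC θ _ hγ1
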